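/- Let Γ be a compact connected subset of a metric space with finite one-dimensional Hausdorff measure. Then there exists a surjective Lipschitz map γ : [0,1] → Γ with Lipschitz constant at most 32·H¹(Γ). -/

import Mathlib

open MeasureTheory ENNReal NNReal

open Filter Topology

section Measure

variable {M : Type*} [MetricSpace M] [MeasurableSpace M] [BorelSpace M]

/-- A connected set through `x` that leaves the ball `B(x, ρ)` has one-dimensional measure at
least `ρ` inside that ball. -/
lemma le_hausdorffMeasure_inter_ball {Γ : Set M} (hconn : IsPreconnected Γ) {x y : M}
    (hx : x ∈ Γ) (hy : y ∈ Γ) {ρ : ℝ} (hxy : ρ ≤ dist y x) :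
    ENNReal.ofReal ρ ≤ μH[1] (Γ ∩ Metric.ball x ρ) := by
  have hlip : LipschitzWith 1 (fun z : M => dist z x) := LipschitzWith.dist_left x
  have hsub : Set.Ico 0 ρ ⊆ (fun z : M => dist z x) '' (Γ ∩ Metric.ball x ρ) := by
    rintro v ⟨hv0, hvρ⟩
    obtain ⟨z, hz, rfl⟩ := hconn.intermediate_value hx hy hlip.continuous.continuousOn
      (show v ∈ Set.Icc (dist x x) (dist y x) from ⟨by simpa using hv0, by linarith⟩)
    exact ⟨z, ⟨hz, hvρ⟩, rfl⟩
  calc ENNReal.ofReal ρ = μH[1] (Set.Ico 0 ρ) := by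
        rw [hausdorffMeasure_real, Real.volume_Ico, sub_zero]
    _ ≤ μH[1] ((fun z : M => dist z x) '' (Γ ∩ Metric.ball x ρ)) := measure_mono hsub
    _ ≤ μH[1] (Γ ∩ Metric.ball x ρ) := by
        simpa using hlip.hausdorffMeasure_image_le zero_le_one (Γ ∩ Metric.ball x ρ)

/-- An `r`-separated finite subset of a connected set of diameter at least `r` has at most
`2 H¹(Γ) / r` points. -/
lemma card_mul_le_hausdorffMeasure {Γ : Set M} (hcomp : IsCompact Γ) (hconn : IsPreconnected Γ)
    (hfin : μH[1] Γ < ⊤) {a b : M} (ha : a ∈ Γ) (hb : b ∈ Γ) {r : ℝ} (hr : 0 < r)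
    (hab : r ≤ dist a b) (S : Finset M) (hS : ↑S ⊆ Γ)
    (hsep : (S : Set M).Pairwise fun x y => r ≤ dist x y) :
    S.card * (r / 2) ≤ (μH[1] Γ).toReal := by
  have hball : ∀ x ∈ S, ENNReal.ofReal (r / 2) ≤ μH[1] (Γ ∩ Metric.ball x (r / 2)) := by
    intro x hx
    by_cases h : r / 2 ≤ dist a x
    · exact le_hausdorffMeasure_inter_ball hconn (hS hx) ha h
    · refine le_hausdorffMeasure_inter_ball hconn (hS hx) hb ?_
      have := dist_triangle_right a b x
      linarith
  have hdisj : (S : Set M).PairwiseDisjoint fun x => Γ ∩ Metric.ball x (r / 2) := by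
    intro x hx y hy hxy
    refine Disjoint.mono Set.inter_subset_right Set.inter_subset_right
      (Metric.ball_disjoint_ball ?_)
    simpa using hsep hx hy hxy
  have hle : S.card * ENNReal.ofReal (r / 2) ≤ μH[1] Γ := by
    calc S.card * ENNReal.ofReal (r / 2) = ∑ _x ∈ S, ENNReal.ofReal (r / 2) := by simp
      _ ≤ ∑ x ∈ S, μH[1] (Γ ∩ Metric.ball x (r / 2)) := Finset.sum_le_sum hball
      _ = μH[1] (⋃ x ∈ S, Γ ∩ Metric.ball x (r / 2)) :=
        (measure_biUnion_finset hdisj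
          fun x _ => hcomp.isClosed.measurableSet.inter Metric.isOpen_ball.measurableSet).symm
      _ ≤ μH[1] Γ := measure_mono (Set.iUnion₂_subset fun _ _ => Set.inter_subset_left)
  have := ENNReal.toReal_mono hfin.ne hle
  rwa [ENNReal.toReal_mul, ENNReal.toReal_natCast, ENNReal.toReal_ofReal (by positivity)] at this

end Measure

section Chain

variable {M : Type*} [MetricSpace M]

/-- A closed walk in `Γ` with steps at most `2r`, running through an `r`-separated set of `k`
points and obtained by inserting detours one point at a time. -/
def HasSeparatedChain (Γ : Set M) (r : ℝ) (L : List M) (S : Finset M) : Prop :=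
  (∀ x, x ∈ L ↔ x ∈ S) ∧ ↑S ⊆ Γ ∧ ((S : Set M).Pairwise fun x y => r ≤ dist x y) ∧
    L.IsChain (fun x y => dist x y ≤ 2 * r) ∧ L.length + 1 = 2 * S.card

/-- A chain whose points do not form an `r`-net of `Γ` can be extended by one point. -/
lemma HasSeparatedChain.exists_extension {Γ : Set M} (hconn : IsPreconnected Γ) {r : ℝ}
    (hr : 0 < r) {L : List M} {S : Finset M} (h : HasSeparatedChain Γ r L S) {z : M} (hz : z ∈ Γ)
    (hfar : ∀ x ∈ L, r < dist z x) :
    ∃ L' S', HasSeparatedChain Γ r L' S' ∧ S'.card = S.card + 1 := by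
  classical
  obtain ⟨hLS, hSΓ, hsep, hchain, hlen⟩ := h
  have hne : (S : Set M).Nonempty := by
    rw [Finset.coe_nonempty, ← Finset.card_pos]; omega
  have hSc : IsCompact (S : Set M) := S.finite_toSet.isCompact
  have hmin : ∀ y, ∃ s ∈ S, Metric.infDist y (S : Set M) = dist y s := fun y =>
    hSc.exists_infDist_eq_dist hne y
  obtain ⟨s₀, hs₀⟩ := hne
  have hzr : r < Metric.infDist z (S : Set M) := by
    obtain ⟨s, hs, hzs⟩ := hmin z
    exact hzs ▸ hfar s ((hLS s).2 hs)
  obtain ⟨t, ht, htv⟩ := hconn.intermediate_value (hSΓ hs₀) hz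
    (Metric.continuous_infDist_pt (S : Set M)).continuousOn
    (show min (2 * r) (Metric.infDist z (S : Set M)) ∈ Set.Icc _ _ from
      ⟨by rw [Metric.infDist_zero_of_mem hs₀]
          exact le_min (by positivity) Metric.infDist_nonneg, min_le_right _ _⟩)
  replace htv : Metric.infDist t (S : Set M) = min (2 * r) (Metric.infDist z (S : Set M)) := htv
  have htr : r < Metric.infDist t (S : Set M) := htv ▸ lt_min (by linarith) hzr
  have hfart : ∀ x ∈ S, r < dist t x := fun x hx =>
    htr.trans_le (Metric.infDist_le_dist_of_mem hx)
  obtain ⟨s, hs, hts⟩ := hmin t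
  have hts2 : dist t s ≤ 2 * r := hts ▸ htv ▸ min_le_left _ _
  have htS : t ∉ S := fun h => by
    have := hfart t h
    rw [dist_self] at this
    linarith
  obtain ⟨l₁, l₂, rfl⟩ := List.append_of_mem ((hLS s).2 hs)
  refine ⟨l₁ ++ s :: t :: s :: l₂, insert t S, ⟨?_, ?_, ?_, ?_, ?_⟩, ?_⟩
  · intro x
    rw [Finset.mem_insert, ← hLS x]
    simp only [List.mem_append, List.mem_cons]
    tauto
  · rw [Finset.coe_insert]
    exact Set.insert_subset ht hSΓ
  · rw [Finset.coe_insert]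
    exact hsep.insert fun x hx _ => ⟨(hfart x hx).le, dist_comm t x ▸ (hfart x hx).le⟩
  · rw [List.isChain_split] at hchain ⊢
    refine ⟨hchain.1, ?_⟩
    rw [List.isChain_cons_cons, List.isChain_cons_cons]
    exact ⟨dist_comm t s ▸ hts2, hts2, hchain.2⟩
  · rw [Finset.card_insert_of_notMem htS]
    simp only [List.length_append, List.length_cons] at hlen ⊢
    omega
  · rw [Finset.card_insert_of_notMem htS]

/-- If the size of separated sets is bounded, some separated chain is an `r`-net of `Γ`. -/
lemma exists_hasSeparatedChain_net {Γ : Set M} (hconn : IsConnected Γ) {r : ℝ} (hr : 0 < r)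
    {N : ℕ} (hN : ∀ L S, HasSeparatedChain Γ r L S → S.card ≤ N) :
    ∃ L S, HasSeparatedChain Γ r L S ∧ ∀ z ∈ Γ, ∃ x ∈ L, dist z x ≤ r := by
  by_contra! hcon
  have hall : ∀ n : ℕ, ∃ L S, HasSeparatedChain Γ r L S ∧ S.card = n + 1 := by
    intro n
    induction n with
    | zero =>
      obtain ⟨a, ha⟩ := hconn.nonempty
      exact ⟨[a], {a}, by simp [HasSeparatedChain, ha], by simp⟩
    | succ n ih =>
      obtain ⟨L, S, h, hcard⟩ := ih
      obtain ⟨z, hz, hfar⟩ := hcon L S h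
      obtain ⟨L', S', h', hcard'⟩ := h.exists_extension hconn.isPreconnected hr hz hfar
      exact ⟨L', S', h', by omega⟩
  obtain ⟨L, S, h, hcard⟩ := hall N
  have := hN L S h
  omega

/-- A sequence with steps at most `δ` gives a step function on `[0, ∞)` that is `C`-Lipschitz
up to an error `δ`. -/
lemma dist_floor_le {f : ℕ → M} {δ C : ℝ} (hδ : 0 < δ) (hC : 0 ≤ C)
    (hf : ∀ i, dist (f i) (f (i + 1)) ≤ δ) {s t : ℝ} (hs : 0 ≤ s) (ht : 0 ≤ t) :
    dist (f ⌊s * (C / δ)⌋₊) (f ⌊t * (C / δ)⌋₊) ≤ C * |s - t| + δ := by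
  wlog hst : s ≤ t generalizing s t
  · rw [dist_comm, abs_sub_comm]
    exact this ht hs (le_of_not_ge hst)
  have hCδ : 0 ≤ C / δ := by positivity
  have hmono : ⌊s * (C / δ)⌋₊ ≤ ⌊t * (C / δ)⌋₊ :=
    Nat.floor_mono (mul_le_mul_of_nonneg_right hst hCδ)
  have h1 := dist_le_Ico_sum_of_dist_le (f := f) hmono (d := fun _ => δ) fun _ _ => hf _
  rw [Finset.sum_const, Nat.card_Ico, nsmul_eq_mul, Nat.cast_sub hmono] at h1
  have h2 := Nat.floor_le (mul_nonneg ht hCδ)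
  have h3 := Nat.lt_floor_add_one (s * (C / δ))
  have hcancel : C / δ * δ = C := div_mul_cancel₀ C hδ.ne'
  calc _ ≤ _ := h1
    _ ≤ (t * (C / δ) - s * (C / δ) + 1) * δ := by gcongr; linarith
    _ = (t - s) * (C / δ * δ) + δ := by ring
    _ = C * |s - t| + δ := by
      rw [hcancel, abs_sub_comm, abs_of_nonneg (sub_nonneg.2 hst), mul_comm]

end Chain

/-- At every small scale `r` there is an approximately Lipschitz map `[0,1] → Γ` whose image is
an `r`-net of `Γ`. -/
lemma exists_approx_parameterization {M : Type*} [MetricSpace M] [MeasurableSpace M]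
    [BorelSpace M] {Γ : Set M} (hcomp : IsCompact Γ) (hconn : IsConnected Γ)
    (hfin : μH[1] Γ < ⊤) {a b : M} (ha : a ∈ Γ) (hb : b ∈ Γ) {r : ℝ} (hr : 0 < r)
    (hab : r ≤ dist a b) :
    ∃ g : ℝ → M, (∀ t, g t ∈ Γ) ∧
      (∀ s t, 0 ≤ s → 0 ≤ t → dist (g s) (g t) ≤ 8 * (μH[1] Γ).toReal * |s - t| + 2 * r) ∧
      ∀ z ∈ Γ, ∃ t ∈ Set.Icc (0 : ℝ) 1, dist z (g t) ≤ r := by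
  set H := (μH[1] Γ).toReal
  have hcard : ∀ L S, HasSeparatedChain Γ r L S → S.card * (r / 2) ≤ H := fun L S h =>
    card_mul_le_hausdorffMeasure hcomp hconn.isPreconnected hfin ha hb hr hab S h.2.1 h.2.2.1
  obtain ⟨L, S, h, hnet⟩ := exists_hasSeparatedChain_net (N := ⌊H / (r / 2)⌋₊) hconn hr
    fun L S h => Nat.le_floor ((le_div_iff₀ (by positivity)).2 (hcard L S h))
  have hSH := hcard L S h
  obtain ⟨hLS, hSΓ, -, hchain, hlen⟩ := h
  have hL : 0 < L.length := by omega
  have hS : (1 : ℝ) ≤ S.card := by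
    exact_mod_cast (by omega : 1 ≤ S.card)
  have hH : 0 < H := by nlinarith
  have hidx : ∀ i, min i (L.length - 1) < L.length := fun i => by omega
  let f : ℕ → M := fun i => L[min i (L.length - 1)]'(hidx i)
  have hstep : ∀ i, dist (f i) (f (i + 1)) ≤ 2 * r := by
    intro i
    by_cases hi : i + 1 < L.length
    · have := hchain.getElem i hi
      simpa [f, Nat.min_eq_left (show i ≤ L.length - 1 by omega),
        Nat.min_eq_left (show i + 1 ≤ L.length - 1 by omega)] using this
    · have h1 : min i (L.length - 1) = min (i + 1) (L.length - 1) := by omega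
      simp only [f, h1, dist_self]
      positivity
  refine ⟨fun t => f ⌊t * (8 * H / (2 * r))⌋₊, fun t => hSΓ ((hLS _).1 (List.getElem_mem _)),
    fun s t hs ht => dist_floor_le (by positivity) (by positivity) hstep hs ht, fun z hz => ?_⟩
  obtain ⟨x, hx, hzx⟩ := hnet z hz
  obtain ⟨i, hi, rfl⟩ := List.getElem_of_mem hx
  refine ⟨i / (8 * H / (2 * r)), ⟨by positivity, ?_⟩, ?_⟩
  · rw [div_le_one (by positivity), le_div_iff₀ (by positivity)]
    have : (i : ℝ) ≤ 2 * S.card := by exact_mod_cast (by omega : i ≤ 2 * S.card)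
    nlinarith
  · have : (0 : ℝ) < 8 * H / (2 * r) := by positivity
    simpa [f, div_mul_cancel₀ _ this.ne', Nat.min_eq_left (show i ≤ L.length - 1 by omega)]
      using hzx

/-- Approximately `C`-Lipschitz maps `[0,1] → Γ` with finer and finer images subconverge, along an
ultrafilter, to a surjective `C`-Lipschitz map. -/
lemma exists_lipschitzOnWith_surjOn_of_approx {M : Type*} [MetricSpace M] {Γ : Set M}
    (hcomp : IsCompact Γ) {C : ℝ≥0} {ε : ℕ → ℝ} (hε : Tendsto ε atTop (𝓝 0)) {g : ℕ → ℝ → M}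
    (hg : ∀ n t, g n t ∈ Γ)
    (hlip : ∀ n s t, 0 ≤ s → 0 ≤ t → dist (g n s) (g n t) ≤ C * |s - t| + ε n)
    (hnet : ∀ n, ∀ z ∈ Γ, ∃ t ∈ Set.Icc (0 : ℝ) 1, dist z (g n t) ≤ ε n) :
    ∃ γ : ℝ → M, LipschitzOnWith C γ (Set.Icc 0 1) ∧ γ '' Set.Icc 0 1 = Γ := by
  let U : Ultrafilter ℕ := Ultrafilter.of atTop
  have hU : (U : Filter ℕ) ≤ atTop := Ultrafilter.of_le atTop
  have hεU : Tendsto ε U (𝓝 0) := hε.mono_left hU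
  have hlim : ∀ t, ∃ y ∈ Γ, Tendsto (fun n => g n t) U (𝓝 y) := fun t =>
    hcomp.ultrafilter_le_nhds (U.map fun n => g n t)
      (le_principal_iff.2 (Filter.mem_map.2 (Filter.univ_mem' fun n => hg n t)))
  choose γ hγΓ hγ using hlim
  refine ⟨γ, LipschitzOnWith.of_dist_le_mul fun s hs t ht => ?_, ?_⟩
  · have h1 := (hγ s).dist (hγ t)
    have h2 : Tendsto (fun n => C * |s - t| + ε n) U (𝓝 (C * |s - t| + 0)) :=
      tendsto_const_nhds.add hεU
    rw [add_zero] at h2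
    exact le_of_tendsto_of_tendsto' h1 h2 fun n => hlip n s t hs.1 ht.1
  · refine Set.Subset.antisymm (Set.image_subset_iff.2 fun t _ => hγΓ t) fun z hz => ?_
    choose τ hτ hzτ using fun n => hnet n z hz
    obtain ⟨t, ht, hτt⟩ : ∃ t ∈ Set.Icc (0 : ℝ) 1, Tendsto τ U (𝓝 t) :=
      isCompact_Icc.ultrafilter_le_nhds (U.map τ)
        (le_principal_iff.2 (Filter.mem_map.2 (Filter.univ_mem' hτ)))
    refine ⟨t, ht, ?_⟩
    have h1 : Tendsto (fun n => dist z (g n t)) U (𝓝 (dist z (γ t))) :=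
      tendsto_const_nhds.dist (hγ t)
    have h2 : Tendsto (fun n => ε n + (C * |τ n - t| + ε n)) U (𝓝 (0 + (C * |t - t| + 0))) :=
      hεU.add (((hτt.sub_const t).abs.const_mul _).add hεU)
    have h3 := le_of_tendsto_of_tendsto' h1 h2 fun n =>
      (dist_triangle z (g n (τ n)) (g n t)).trans
        (add_le_add (hzτ n) (hlip n _ _ (hτ n).1 ht.1))
    rw [sub_self, abs_zero, mul_zero, add_zero, add_zero] at h3
    exact (dist_le_zero.1 h3).symm

/-- A compact connected set `Γ` of finite `H¹` measure in a metric space is the image of a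
Lipschitz map `γ : [0,1] → M` with Lipschitz constant at most `32 · H¹(Γ)`. -/
theorem exists_lipschitz_parameterization {M : Type*} [MetricSpace M] [MeasurableSpace M]
    [BorelSpace M] (Γ : Set M) (hcomp : IsCompact Γ) (hconn : IsConnected Γ)
    (hfin : μH[1] Γ < ⊤) :
    ∃ (γ : ℝ → M) (K : NNReal), LipschitzOnWith K γ (Set.Icc 0 1) ∧
      γ '' Set.Icc 0 1 = Γ ∧ (K : ℝ≥0∞) ≤ 32 * μH[1] Γ := by
  rcases Γ.subsingleton_or_nontrivial with hsub | ⟨a, ha, b, hb, hab⟩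
  · obtain ⟨a, ha⟩ := hconn.nonempty
    refine ⟨fun _ => a, 0, (LipschitzWith.const a).lipschitzOnWith, ?_, by simp⟩
    rw [Set.Nonempty.image_const (Set.nonempty_Icc.2 zero_le_one), hsub.eq_singleton_of_mem ha]
  have hd : 0 < dist a b := dist_pos.2 hab
  let r : ℕ → ℝ := fun n => dist a b / (n + 1)
  have hr : ∀ n, 0 < r n := fun n => by positivity
  have hrd : ∀ n, r n ≤ dist a b := fun n => div_le_self hd.le (by simp)
  choose g hg hlip hnet using fun n =>
    exists_approx_parameterization hcomp hconn hfin ha hb (hr n) (hrd n)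
  have hr0 : Tendsto (fun n => 2 * r n) atTop (𝓝 0) := by
    simpa [r, div_eq_mul_inv] using
      (tendsto_one_div_add_atTop_nhds_zero_nat (𝕜 := ℝ)).const_mul (2 * dist a b)
        |>.congr fun n => by ring
  obtain ⟨γ, hγ, himg⟩ := exists_lipschitzOnWith_surjOn_of_approx hcomp
    (C := 8 * (μH[1] Γ).toNNReal) hr0 hg (by push_cast; exact hlip) fun n z hz => by
      obtain ⟨t, ht, hzt⟩ := hnet n z hz
      exact ⟨t, ht, by linarith [hr n]⟩
  refine ⟨γ, _, hγ, himg, ?_⟩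
  rw [ENNReal.coe_mul, ENNReal.coe_toNNReal hfin.ne]
  gcongr
  norm_num
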